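/- Let A be a finite-dimensional algebra over an algebraically closed field and T a generalized tilting A-module. Then the projective dimension of T equals the length of a minimal coresolution of the regular module A by modules in add(T). -/

import Mathlib

open CategoryTheory Opposite Limits

attribute [local instance] CategoryTheory.Abelian.hasFiniteBiproducts

universe u v

variable {C : Type u} [Category.{v} C] [Abelian C] [EnoughProjectives C]

/-- The `i`-th Ext group (with `ℤ`-linear structure). -/
noncomputable def extGrp (i : ℕ) (X Y : C) : ModuleCat ℤ := ((Ext ℤ C i).obj (op X)).obj Y

/-- `X` has projective dimension at most `n`: all higher Ext groups vanish. -/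
def projDimLE (X : C) (n : ℕ) : Prop := ∀ i : ℕ, n < i → ∀ Y : C, IsZero (extGrp i X Y)

/-- The projective dimension of `X`, as an element of `ℕ∞` (`⊤` if infinite). -/
noncomputable def projDim (X : C) : ℕ∞ :=
  sInf {n : ℕ∞ | ∃ m : ℕ, n = (m : ℕ∞) ∧ projDimLE X m}

/-- `X` belongs to `add T`: it is a direct summand of a finite direct sum of copies of `T`. -/
def inAdd (T X : C) : Prop := ∃ (Y : C) (n : ℕ), Nonempty ((X ⊞ Y) ≅ ⨁ (fun _ : Fin n => T))

/-- `X` is a direct summand of `Y`. -/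
def isSummand (X Y : C) : Prop := ∃ Z : C, Nonempty (Y ≅ X ⊞ Z)

/-- A finite coresolution `0 ⟶ X ⟶ Q 0 ⟶ Q 1 ⟶ ⋯ ⟶ Q k ⟶ 0`
(the terms `Q i` vanish for `i > k`). -/
structure FinCoresolution (X : C) (k : ℕ) where
  Q : ℕ → C
  η : X ⟶ Q 0
  d : ∀ i : ℕ, Q i ⟶ Q (i + 1)
  mono_η : Mono η
  zero0 : η ≫ d 0 = 0
  zero : ∀ i, d i ≫ d (i + 1) = 0
  exact0 : (ShortComplex.mk η (d 0) zero0).Exact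
  exactness : ∀ i, (ShortComplex.mk (d i) (d (i + 1)) (zero i)).Exact
  bounded : ∀ i, k < i → IsZero (Q i)

section ExtVanishing

variable [HasExt.{v} C]

omit [EnoughProjectives C] in
/-- Vanishing of a positive Ext group in terms of cocycles on a projective resolution. -/
lemma subsingleton_ext_iff_of_projectiveResolution {X : C} (P : ProjectiveResolution X) (Y : C)
    (i : ℕ) :
    Subsingleton (Abelian.Ext X Y (i + 1)) ↔
      ∀ f : P.complex.X (i + 1) ⟶ Y, P.complex.d (i + 2) (i + 1) ≫ f = 0 →
        ∃ g : P.complex.X i ⟶ Y, P.complex.d (i + 1) i ≫ g = f := by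
  constructor
  · intro h f hf
    exact (P.extMk_eq_zero_iff f (i + 2) rfl hf i rfl).1 (Subsingleton.elim _ _)
  · intro h
    refine subsingleton_of_forall_eq 0 fun α => ?_
    obtain ⟨f, hf, rfl⟩ := P.extMk_surjective α (i + 2) rfl
    exact (P.extMk_eq_zero_iff f (i + 2) rfl hf i rfl).2 (h f hf)

lemma isZero_extGrp_iff_subsingleton_ext (X Y : C) (i : ℕ) :
    IsZero (extGrp (i + 1) X Y) ↔ Subsingleton (Abelian.Ext X Y (i + 1)) := by
  let P := ProjectiveResolution.of X
  rw [subsingleton_ext_iff_of_projectiveResolution P]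
  refine (P.isoExt (R := ℤ) (i + 1) Y).isZero_iff.trans ?_
  rw [← HomologicalComplex.exactAt_iff_isZero_homology,
    HomologicalComplex.exactAt_iff' _ i (i + 1) (i + 2) (by simp) (by simp),
    ShortComplex.moduleCat_exact_iff]
  rfl

omit [EnoughProjectives C] in
lemma subsingleton_ext_X₃ {S : ShortComplex C} (hS : S.ShortExact) (X : C) {i j : ℕ}
    (hij : i + 1 = j) (h₂ : Subsingleton (Abelian.Ext X S.X₂ i))
    (h₁ : Subsingleton (Abelian.Ext X S.X₁ j)) : Subsingleton (Abelian.Ext X S.X₃ i) := by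
  refine subsingleton_of_forall_eq 0 fun x => ?_
  obtain ⟨y, rfl⟩ := Abelian.Ext.covariant_sequence_exact₃ X hS x hij (Subsingleton.elim _ _)
  simp [Subsingleton.elim y 0]

omit [EnoughProjectives C] in
lemma subsingleton_ext_X₁ {S : ShortComplex C} (hS : S.ShortExact) (X : C) {i j : ℕ}
    (hij : i + 1 = j) (h₃ : Subsingleton (Abelian.Ext X S.X₃ i))
    (h₂ : Subsingleton (Abelian.Ext X S.X₂ j)) : Subsingleton (Abelian.Ext X S.X₁ j) := by
  refine subsingleton_of_forall_eq 0 fun x => ?_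
  obtain ⟨y, rfl⟩ := Abelian.Ext.covariant_sequence_exact₁ X hS x (Subsingleton.elim _ _) hij
  simp [Subsingleton.elim y 0]

lemma subsingleton_ext_pi {J : Type*} (X : C) (Y : J → C) [HasProduct Y] (i : ℕ)
    (h : ∀ j, Subsingleton (Abelian.Ext X (Y j) (i + 1))) :
    Subsingleton (Abelian.Ext X (∏ᶜ Y) (i + 1)) := by
  simp_rw [subsingleton_ext_iff_of_projectiveResolution (ProjectiveResolution.of X)] at h ⊢
  intro f hf
  choose g hg using fun j => h j (f ≫ Pi.π Y j) (by rw [reassoc_of% hf, zero_comp])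
  exact ⟨Pi.lift g, Pi.hom_ext _ _ fun j => by simp [hg]⟩

omit [EnoughProjectives C] in
/-- In a short exact sequence with `Ext¹(X₃, X₁) = 0`, the epimorphism has a section. -/
lemma nonempty_splitting_of_subsingleton_ext {S : ShortComplex C} (hS : S.ShortExact)
    (h : Subsingleton (Abelian.Ext S.X₃ S.X₁ 1)) : Nonempty S.Splitting := by
  obtain ⟨x, hx⟩ := Abelian.Ext.covariant_sequence_exact₃ S.X₃ hS
    (Abelian.Ext.mk₀ (𝟙 S.X₃)) (zero_add 1) (Subsingleton.elim _ _)
  obtain ⟨s, rfl⟩ := (Abelian.Ext.mk₀_bijective _ _).2 x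
  rw [Abelian.Ext.mk₀_comp_mk₀] at hx
  exact ⟨.ofExactOfSection S hS.exact s ((Abelian.Ext.mk₀_bijective _ _).1 hx) hS.mono_f⟩

end ExtVanishing

section AddClosure

omit [EnoughProjectives C]

lemma inAdd.exists_sum_eq_id {T X : C} (h : inAdd T X) :
    ∃ (n : ℕ) (a : Fin n → (X ⟶ T)) (b : Fin n → (T ⟶ X)), ∑ j, a j ≫ b j = 𝟙 X := by
  obtain ⟨Y, n, ⟨e⟩⟩ := h
  refine ⟨n, fun j => biprod.inl ≫ e.hom ≫ biproduct.π _ j,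
    fun j => biproduct.ι (fun _ : Fin n => T) j ≫ e.inv ≫ biprod.fst, ?_⟩
  have := congrArg (fun t => biprod.inl ≫ e.hom ≫ t ≫ e.inv ≫ biprod.fst)
    (biproduct.total (f := fun _ : Fin n => T))
  simpa only [Preadditive.sum_comp, Preadditive.comp_sum, Category.assoc, Category.id_comp,
    Iso.hom_inv_id_assoc, biprod.inl_fst] using this

lemma inAdd.of_iso {T X X' : C} (h : inAdd T X) (e : X' ≅ X) : inAdd T X' := by
  obtain ⟨Y, n, ⟨e'⟩⟩ := h
  exact ⟨Y, n, ⟨biprod.mapIso e (Iso.refl Y) ≪≫ e'⟩⟩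

lemma inAdd.of_biprod {T X Y : C} (h : inAdd T (X ⊞ Y)) : inAdd T X := by
  obtain ⟨Z, n, ⟨e⟩⟩ := h
  exact ⟨Y ⊞ Z, n, ⟨(biprod.associator X Y Z).symm ≪≫ e⟩⟩

lemma inAdd.of_isZero {X : C} (T : C) (h : IsZero X) : inAdd T X := by
  refine ⟨X, 0, ⟨IsZero.iso ?_ ?_⟩⟩
  · rw [IsZero.iff_id_eq_zero]
    ext <;> exact h.eq_of_src _ _
  · rw [IsZero.iff_id_eq_zero]
    ext j
    exact j.elim0

variable [HasExt.{v} C]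

lemma inAdd.subsingleton_ext_left {T X Y : C} (h : inAdd T X) {i : ℕ}
    (hT : Subsingleton (Abelian.Ext T Y i)) : Subsingleton (Abelian.Ext X Y i) := by
  obtain ⟨n, a, b, hab⟩ := h.exists_sum_eq_id
  refine subsingleton_of_forall_eq 0 fun x => ?_
  have key : ∀ f : X ⟶ X, (Abelian.Ext.mk₀ f).comp x (zero_add i) =
      ((Abelian.Ext.bilinearComp X X Y 0 i i (zero_add i)).comp
        Abelian.Ext.addEquiv₀.symm.toAddMonoidHom) f x := fun f => rfl
  rw [← Abelian.Ext.mk₀_id_comp x, ← hab, key, map_sum, AddMonoidHom.finsetSum_apply]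
  refine Finset.sum_eq_zero fun j _ => ?_
  rw [← key, ← Abelian.Ext.mk₀_comp_mk₀_assoc,
    Subsingleton.elim ((Abelian.Ext.mk₀ (b j)).comp x (zero_add i)) 0, Abelian.Ext.comp_zero]

lemma inAdd.subsingleton_ext_right {T X Y : C} (h : inAdd T Y) {i : ℕ}
    (hT : Subsingleton (Abelian.Ext X T i)) : Subsingleton (Abelian.Ext X Y i) := by
  obtain ⟨n, a, b, hab⟩ := h.exists_sum_eq_id
  refine subsingleton_of_forall_eq 0 fun x => ?_
  have key : ∀ f : Y ⟶ Y, x.comp (Abelian.Ext.mk₀ f) (add_zero i) =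
      ((Abelian.Ext.bilinearComp X Y Y i 0 i (add_zero i) x).comp
        Abelian.Ext.addEquiv₀.symm.toAddMonoidHom) f := fun f => rfl
  rw [← Abelian.Ext.comp_mk₀_id x, ← hab, key, map_sum]
  refine Finset.sum_eq_zero fun j _ => ?_
  rw [← key, ← Abelian.Ext.mk₀_comp_mk₀, ← Abelian.Ext.comp_assoc_of_second_deg_zero,
    Subsingleton.elim (x.comp (Abelian.Ext.mk₀ (a j)) (add_zero i)) 0, Abelian.Ext.zero_comp]

end AddClosure

section Coresolution

omit [EnoughProjectives C]

/-- `HasAddCoresolution T X n`: the object `X` has a coresolution of length at most `n` by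
objects of `add T`, presented as a chain of short exact sequences. -/
inductive HasAddCoresolution (T : C) : C → ℕ → Prop
  | zero {X : C} (h : inAdd T X) : HasAddCoresolution T X 0
  | succ {S : ShortComplex C} {n : ℕ} (hS : S.ShortExact) (h₂ : inAdd T S.X₂)
      (h₃ : HasAddCoresolution T S.X₃ n) : HasAddCoresolution T S.X₁ (n + 1)

lemma HasAddCoresolution.inAdd_of_zero {T X : C} (h : HasAddCoresolution T X 0) : inAdd T X := by
  cases h with
  | zero h => exact h

lemma FinCoresolution.hasAddCoresolution {T X : C} {n : ℕ} (R : FinCoresolution X n)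
    (hR : ∀ i, inAdd T (R.Q i)) : HasAddCoresolution T X n := by
  induction n generalizing X with
  | zero =>
    have := R.mono_η
    have h0 : R.d 0 = 0 := (R.bounded 1 one_pos).eq_of_tgt _ _
    have : Epi R.η := (ShortComplex.exact_iff_epi _ h0).1 R.exact0
    have := isIso_of_mono_of_epi R.η
    exact .zero ((hR 0).of_iso (asIso R.η))
  | succ n ih =>
    have hmono := R.mono_η
    let S := ShortComplex.mk R.η (cokernel.π R.η) (cokernel.condition _)
    have hS : S.ShortExact :=
      { exact := ShortComplex.exact_of_g_is_cokernel _ (cokernelIsCokernel R.η)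
        mono_f := hmono
        epi_g := inferInstanceAs (Epi (cokernel.π R.η)) }
    have hπ : cokernel.π R.η ≫ cokernel.desc R.η (R.d 0) R.zero0 = R.d 0 := by simp
    have hz : cokernel.desc R.η (R.d 0) R.zero0 ≫ R.d 1 = 0 := by
      rw [← cancel_epi (cokernel.π R.η), reassoc_of% hπ, R.zero 0, comp_zero]
    let R' : FinCoresolution (cokernel R.η) n :=
      { Q := fun i => R.Q (i + 1)
        η := cokernel.desc R.η (R.d 0) R.zero0
        d := fun i => R.d (i + 1)
        mono_η := (ShortComplex.exact_iff_mono_cokernel_desc _).1 R.exact0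
        zero0 := hz
        zero := fun i => R.zero (i + 1)
        exact0 := by
          let φ : ShortComplex.mk (R.d 0) (R.d 1) (R.zero 0) ⟶ ShortComplex.mk _ _ hz :=
            { τ₁ := cokernel.π R.η
              τ₂ := 𝟙 _
              τ₃ := 𝟙 _
              comm₁₂ := by simp
              comm₂₃ := by simp }
          have : Epi φ.τ₁ := inferInstanceAs (Epi (cokernel.π R.η))
          have : IsIso φ.τ₂ := inferInstanceAs (IsIso (𝟙 _))
          have : Mono φ.τ₃ := inferInstanceAs (Mono (𝟙 _))
          exact (ShortComplex.exact_iff_of_epi_of_isIso_of_mono φ).1 (R.exactness 0)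
        exactness := fun i => R.exactness (i + 1)
        bounded := fun i hi => R.bounded (i + 1) (by lia) }
    exact .succ hS (hR 0) (ih R' fun i => hR (i + 1))

/-- Splice a short exact sequence with a coresolution of its third term. -/
noncomputable def FinCoresolution.cons {S : ShortComplex C} (hS : S.ShortExact) {n : ℕ}
    (R : FinCoresolution S.X₃ n) : FinCoresolution S.X₁ (n + 1) where
  Q
    | 0 => S.X₂
    | i + 1 => R.Q i
  η := S.f
  d
    | 0 => S.g ≫ R.η
    | i + 1 => R.d i
  mono_η := hS.mono_f
  zero0 := by simp
  zero
    | 0 => by simp [R.zero0]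
    | i + 1 => R.zero i
  exact0 := by
    let φ : S ⟶ ShortComplex.mk S.f (S.g ≫ R.η) (by simp) :=
      { τ₁ := 𝟙 _
        τ₂ := 𝟙 _
        τ₃ := R.η
        comm₁₂ := by simp
        comm₂₃ := by simp }
    have : Epi φ.τ₁ := inferInstanceAs (Epi (𝟙 _))
    have : IsIso φ.τ₂ := inferInstanceAs (IsIso (𝟙 _))
    have : Mono φ.τ₃ := R.mono_η
    exact (ShortComplex.exact_iff_of_epi_of_isIso_of_mono φ).1 hS.exact
  exactness
    | 0 => by
      let φ : ShortComplex.mk (S.g ≫ R.η) (R.d 0) (by simp [R.zero0]) ⟶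
          ShortComplex.mk R.η (R.d 0) R.zero0 :=
        { τ₁ := S.g
          τ₂ := 𝟙 _
          τ₃ := 𝟙 _
          comm₁₂ := by simp
          comm₂₃ := by simp }
      have : Epi φ.τ₁ := hS.epi_g
      have : IsIso φ.τ₂ := inferInstanceAs (IsIso (𝟙 _))
      have : Mono φ.τ₃ := inferInstanceAs (Mono (𝟙 _))
      exact (ShortComplex.exact_iff_of_epi_of_isIso_of_mono φ).2 R.exact0
    | i + 1 => R.exactness i
  bounded
    | 0, h => by lia
    | i + 1, h => R.bounded i (by lia)

open ZeroObject in
/-- The coresolution of an object by itself. -/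
noncomputable def FinCoresolution.self (X : C) : FinCoresolution X 0 where
  Q
    | 0 => X
    | _ + 1 => 0
  η := 𝟙 X
  d _ := 0
  mono_η := inferInstance
  zero0 := comp_zero
  zero _ := comp_zero
  exact0 := (ShortComplex.exact_iff_epi _ rfl).2 (inferInstanceAs (Epi (𝟙 X)))
  exactness _ := ShortComplex.exact_of_isZero_X₂ _ (isZero_zero C)
  bounded
    | 0, h => by lia
    | _ + 1, _ => isZero_zero C

lemma HasAddCoresolution.exists_finCoresolution {T X : C} {n : ℕ}
    (h : HasAddCoresolution T X n) : ∃ R : FinCoresolution X n, ∀ i, inAdd T (R.Q i) := by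
  induction h with
  | zero h =>
    refine ⟨.self _, fun i => ?_⟩
    cases i with
    | zero => exact h
    | succ i => exact .of_isZero T (isZero_zero C)
  | succ hS h₂ _ ih =>
    obtain ⟨R, hR⟩ := ih
    refine ⟨.cons hS R, fun i => ?_⟩
    cases i with
    | zero => exact h₂
    | succ i => exact hR i

/-- Weaken the length bound of a coresolution. -/
def FinCoresolution.ofLE {X : C} {m n : ℕ} (R : FinCoresolution X m) (h : m ≤ n) :
    FinCoresolution X n :=
  { R with bounded := fun i hi => R.bounded i (h.trans_lt hi) }

variable [HasExt.{v} C] {T : C}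

lemma HasAddCoresolution.subsingleton_ext
    (hT : ∀ i : ℕ, Subsingleton (Abelian.Ext T T (i + 1))) {X : C} {n : ℕ}
    (h : HasAddCoresolution T X n) (i : ℕ) (hi : n ≤ i) :
    Subsingleton (Abelian.Ext T X (i + 1)) := by
  induction h generalizing i with
  | zero h => exact h.subsingleton_ext_right (hT i)
  | succ hS h₂ _ ih =>
    obtain ⟨i, rfl⟩ : ∃ l, i = l + 1 := ⟨i - 1, by lia⟩
    exact subsingleton_ext_X₁ hS T rfl (ih i (by lia)) (h₂.subsingleton_ext_right (hT _))

/-- A coresolution of length `n + 1` of `X` can be shortened if `Extⁿ⁺¹(T, X) = 0`. -/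
lemma HasAddCoresolution.shorten
    (hT : ∀ i : ℕ, Subsingleton (Abelian.Ext T T (i + 1))) {X : C} {n : ℕ}
    (h : HasAddCoresolution T X (n + 1)) (hX : Subsingleton (Abelian.Ext T X (n + 1))) :
    HasAddCoresolution T X n := by
  induction n generalizing X with
  | zero =>
    cases h with
    | succ hS h₂ h₃ =>
      obtain ⟨s⟩ := nonempty_splitting_of_subsingleton_ext hS
        (h₃.inAdd_of_zero.subsingleton_ext_left hX)
      exact .zero (inAdd.of_biprod (h₂.of_iso s.isoBinaryBiproduct.symm))
  | succ n ih =>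
    cases h with
    | succ hS h₂ h₃ =>
      exact .succ hS h₂ (ih h₃ (subsingleton_ext_X₃ hS T rfl
        (h₂.subsingleton_ext_right (hT n)) hX))

lemma HasAddCoresolution.of_le
    (hT : ∀ i : ℕ, Subsingleton (Abelian.Ext T T (i + 1))) {X : C} {m n : ℕ}
    (h : HasAddCoresolution T X n) (hmn : m ≤ n)
    (hX : ∀ i, m ≤ i → Subsingleton (Abelian.Ext T X (i + 1))) :
    HasAddCoresolution T X m := by
  induction n, hmn using Nat.le_induction with
  | base => exact h
  | succ n hmn ih => exact ih (h.shorten hT (hX n hmn))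

/-- If every object is a quotient of an object with no higher Ext from `T` beyond degree `n`,
and `T` has finite projective dimension, then `T` has projective dimension at most `n`. -/
lemma subsingleton_ext_of_forall_exists_epi {n m : ℕ}
    (hm : ∀ i, m ≤ i → ∀ Y : C, Subsingleton (Abelian.Ext T Y (i + 1)))
    (hn : ∀ Y : C, ∃ (F : C) (p : F ⟶ Y), Epi p ∧
      ∀ i, n ≤ i → Subsingleton (Abelian.Ext T F (i + 1)))
    (i : ℕ) (hi : n ≤ i) (Y : C) : Subsingleton (Abelian.Ext T Y (i + 1)) := by
  induction h : m - i generalizing i Y with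
  | zero => exact hm i (by lia) Y
  | succ l ih =>
    obtain ⟨F, p, hp, hF⟩ := hn Y
    have hS : (ShortComplex.mk (kernel.ι p) p (kernel.condition p)).ShortExact :=
      { exact := ShortComplex.exact_of_f_is_kernel _ (kernelIsKernel p)
        mono_f := inferInstanceAs (Mono (kernel.ι p))
        epi_g := hp }
    exact subsingleton_ext_X₃ hS T rfl (hF i hi) (ih _ (by lia) _ (by lia))

end Coresolution

/-- Over a finite-dimensional algebra, every module is a quotient of a product of copies of the
regular module. -/
lemma exists_surjective_pi_of_finiteDimensional (k : Type*) [Field k] (A : Type*) [Ring A]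
    [Algebra k A] [FiniteDimensional k A] (X : Type*) [AddCommGroup X] [Module A X] :
    ∃ φ : (X → A) →ₗ[A] X, Function.Surjective φ := by
  let _ : Module k X := Module.compHom X (algebraMap k A)
  have : IsScalarTower k A X := .of_algebraMap_smul fun _ _ => rfl
  have : SMulCommClass k A X := IsScalarTower.to_smulCommClass
  let ι : (X →₀ k) →ₗ[k] (X → k) := Finsupp.lcoeFun
  obtain ⟨r, hr⟩ := ι.exists_leftInverse_of_injective
    (LinearMap.ker_eq_bot.2 DFunLike.coe_injective)
  let ρ : (X → k) →ₗ[k] X := (Finsupp.linearCombination k id).comp r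
  have hρ (x : X) : ρ (ι (Finsupp.single x 1)) = x := by
    have := LinearMap.congr_fun hr (Finsupp.single x 1)
    simp only [LinearMap.comp_apply, LinearMap.id_apply] at this
    simp [ρ, this]
  let b := Module.finBasis k A
  let c (l : Fin (Module.finrank k A)) : (X → A) →ₗ[k] (X → k) := (b.coord l).compLeft X
  let φ : (X → A) →ₗ[A] X :=
    { toFun := fun f => ∑ l, b l • ρ (c l f)
      map_add' := fun f g => by simp [smul_add, Finset.sum_add_distrib]
      map_smul' := fun a f => by
        have hc (l) : c l (a • f) = ∑ m, b.coord l (a * b m) • c m f := by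
          ext x
          have := congrArg (fun t => b.coord l (a * t)) (b.sum_repr (f x))
          simp only [Finset.mul_sum, map_sum, mul_smul_comm, map_smul] at this
          simpa [c, mul_comm] using this.symm
        have hb (m) : a * b m = ∑ l, b.coord l (a * b m) • b l := (b.sum_repr _).symm
        simp only [hc, map_sum, map_smul, Finset.smul_sum, RingHom.id_apply, ← mul_smul]
        rw [Finset.sum_comm]
        refine Finset.sum_congr rfl fun m _ => ?_
        conv_rhs => rw [hb m, Finset.sum_smul]
        exact Finset.sum_congr rfl fun l _ => by rw [smul_comm, smul_assoc] }
  classical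
  refine ⟨φ, fun x => ⟨Pi.single x 1, ?_⟩⟩
  have hc (l) : c l (Pi.single x 1) = b.coord l 1 • ι (Finsupp.single x 1) := by
    ext y
    by_cases h : y = x
    · subst h
      simp [c, ι]
    · simp [c, ι, h]
  change ∑ l, b l • ρ (c l (Pi.single x 1)) = x
  simp only [hc, map_smul, hρ]
  calc ∑ l, b l • b.coord l 1 • x = (∑ l, b.coord l 1 • b l) • x := by
        rw [Finset.sum_smul]
        exact Finset.sum_congr rfl fun l _ => by rw [smul_comm, smul_assoc]
    _ = x := by rw [show ∑ l, b.coord l 1 • b l = 1 from b.sum_repr 1, one_smul]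

lemma projDimLE_iff_subsingleton_ext [HasExt.{v} C] (X : C) (n : ℕ) :
    projDimLE X n ↔ ∀ i, n ≤ i → ∀ Y : C, Subsingleton (Abelian.Ext X Y (i + 1)) := by
  simp_rw [← isZero_extGrp_iff_subsingleton_ext]
  refine ⟨fun h i hi => h (i + 1) (by lia), fun h i hi => ?_⟩
  obtain ⟨i, rfl⟩ : ∃ l, i = l + 1 := ⟨i - 1, by lia⟩
  exact h i (by lia)

/-- For a generalized tilting module `T` (in the sense of Miyashita) over a
finite-dimensional algebra `A`, the projective dimension of `T` equals the minimal length
of a coresolution of the regular module `A` by modules in `add T`. -/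
theorem stmt_3 (k : Type) [Field k] [IsAlgClosed k]
    (A : Type) [Ring A] [Algebra k A] [FiniteDimensional k A]
    (T : ModuleCat A)
    -- (1) T has finite projective dimension
    (h1 : ∃ m : ℕ, projDimLE T m)
    -- (2) T is ext-self-orthogonal
    (h2 : ∀ i : ℕ, 0 < i → IsZero (extGrp i T T))
    -- (3) the regular module has a finite coresolution by modules in add T
    (h3 : ∃ (m : ℕ) (R : FinCoresolution (ModuleCat.of A A) m), ∀ i, inAdd T (R.Q i)) :
    projDim T =
      sInf {n : ℕ∞ | ∃ m : ℕ, n = (m : ℕ∞) ∧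
        ∃ R : FinCoresolution (ModuleCat.of A A) m, ∀ i, inAdd T (R.Q i)} := by
  have hT (i : ℕ) : Subsingleton (Abelian.Ext T T (i + 1)) :=
    (isZero_extGrp_iff_subsingleton_ext T T i).1 (h2 _ i.succ_pos)
  have key (n : ℕ) : projDimLE T n ↔
      ∃ R : FinCoresolution (ModuleCat.of A A) n, ∀ i, inAdd T (R.Q i) := by
    rw [projDimLE_iff_subsingleton_ext]
    constructor
    · intro hn
      obtain ⟨m, R, hR⟩ := h3
      obtain hmn | hnm := le_total m n
      · exact ⟨R.ofLE hmn, hR⟩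
      · exact ((R.hasAddCoresolution hR).of_le hT hnm
          fun i hi => hn i hi _).exists_finCoresolution
    · rintro ⟨R, hR⟩
      obtain ⟨m, hm⟩ := h1
      refine subsingleton_ext_of_forall_exists_epi
        ((projDimLE_iff_subsingleton_ext T m).1 hm) fun Y => ?_
      obtain ⟨φ, hφ⟩ := exists_surjective_pi_of_finiteDimensional k A Y
      have hepi : Epi (ModuleCat.ofHom φ) := (ModuleCat.epi_iff_surjective _).2 hφ
      exact ⟨∏ᶜ fun _ : Y => ModuleCat.of A A,
        (ModuleCat.piIsoPi fun _ : Y => ModuleCat.of A A).hom ≫ ModuleCat.ofHom φ,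
        epi_comp _ _, fun i hi => subsingleton_ext_pi T _ i fun _ =>
          (R.hasAddCoresolution hR).subsingleton_ext hT i hi⟩
  simp only [projDim, key]
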